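/- Let f : ℝ^n → ℝ be convex, differentiable, and locally smooth, with a minimizer x* and optimal value f*. Let (x_k) be generated by x_{k+1} = x_k − α_k ∇f(x_k) with ∇f(x_k) ≠ 0 for all k, where for all k ≥ 0 (given α_{−1} > 0 and γ_{−1} ∈ (0,1)) α_k = min{γ_k/L_k, (α_{k−1}/γ_k²)(1 − γ_k²)/(1 − γ_{k−1}²)} with γ_k ∈ (0,1) and L_k := ‖∇f(x_{k+1}) − ∇f(x_k)‖/‖x_{k+1} − x_k‖. Let D be any convex compact set containing x* and all iterates x_k, on which ∇f is L_D-Lipschitz (L_D > 0). Then for every n ≥ 1, Σ_{k=0}^{n−1} (α_k/L_D)·‖∇f(x_k)‖² ≤ ‖x_0 − x*‖² + 2 α_0·(γ_0²/(1 − γ_0²))·(f(x_0) − f*); in particular Σ_k α_k ‖∇f(x_k)‖² < ∞. -/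

import Mathlib

open scoped RealInnerProductSpace

theorem hasDerivAt_comp_add_smul {E : Type*} [NormedAddCommGroup E] [InnerProductSpace ℝ E]
    [CompleteSpace E] {f : E → ℝ} {f' : E → E} (hf : ∀ z, HasGradientAt f (f' z) z)
    (x v : E) (t : ℝ) :
    HasDerivAt (fun t : ℝ => f (x + t • v)) ⟪f' (x + t • v), v⟫ t := by
  have h : HasDerivAt (fun t : ℝ => x + t • v) v t := by
    simpa using ((hasDerivAt_id t).smul_const v).const_add x
  simpa [Function.comp_def] using (hf (x + t • v)).hasFDerivAt.comp_hasDerivAt t h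

theorem ConvexOn.add_inner_gradient_le {E : Type*} [NormedAddCommGroup E]
    [InnerProductSpace ℝ E] [CompleteSpace E] {f : E → ℝ} {f' : E → E}
    (hconv : ConvexOn ℝ Set.univ f) (hf : ∀ z, HasGradientAt f (f' z) z) (x y : E) :
    f x + ⟪f' x, y - x⟫ ≤ f y := by
  have hc : ConvexOn ℝ Set.univ (fun t : ℝ => f (x + t • (y - x))) := by
    have := hconv.comp_affineMap (AffineMap.lineMap x y : ℝ →ᵃ[ℝ] E)
    simpa [Function.comp_def, AffineMap.lineMap_apply, add_comm] using this
  have h := hc.le_slope_of_hasDerivAt (Set.mem_univ 0) (Set.mem_univ 1) one_pos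
    (hasDerivAt_comp_add_smul hf x (y - x) 0)
  simp [slope_def_field] at h
  linarith

/-- The descent lemma on a convex set on which the gradient is Lipschitz. -/
theorem le_add_inner_gradient_add_sq {E : Type*} [NormedAddCommGroup E]
    [InnerProductSpace ℝ E] [CompleteSpace E] {f : E → ℝ} {f' : E → E}
    (hf : ∀ z, HasGradientAt f (f' z) z) {D : Set E} (hD : Convex ℝ D) {L : ℝ}
    (hLip : ∀ u ∈ D, ∀ v ∈ D, ‖f' v - f' u‖ ≤ L * ‖v - u‖) {x y : E} (hx : x ∈ D)
    (hy : y ∈ D) :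
    f y ≤ f x + ⟪f' x, y - x⟫ + L / 2 * ‖y - x‖ ^ 2 := by
  have hd : ∀ t : ℝ, HasDerivAt
      (fun t : ℝ => f (x + t • (y - x)) - t * ⟪f' x, y - x⟫ - L / 2 * ‖y - x‖ ^ 2 * t ^ 2)
      (⟪f' (x + t • (y - x)), y - x⟫ - ⟪f' x, y - x⟫ - L / 2 * ‖y - x‖ ^ 2 * (2 * t)) t := by
    intro t
    have h2 := (hasDerivAt_id t).mul_const ⟪f' x, y - x⟫
    have h3 := ((hasDerivAt_id t).pow 2).const_mul (L / 2 * ‖y - x‖ ^ 2)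
    simpa [Pi.sub_def] using ((hasDerivAt_comp_add_smul hf x (y - x) t).sub h2).sub h3
  have hanti := antitoneOn_of_deriv_nonpos (convex_Icc (0 : ℝ) 1)
    (fun t _ => (hd t).continuousAt.continuousWithinAt)
    (fun t _ => (hd t).differentiableAt.differentiableWithinAt) (fun t ht => by
      rw [interior_Icc] at ht
      rw [(hd t).deriv, ← inner_sub_left]
      have h1 := real_inner_le_norm (f' (x + t • (y - x)) - f' x) (y - x)
      have h2 := hLip x hx _ (hD.add_smul_sub_mem hx hy ⟨ht.1.le, ht.2.le⟩)
      rw [add_sub_cancel_left, norm_smul, Real.norm_of_nonneg ht.1.le] at h2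
      nlinarith [mul_le_mul_of_nonneg_right h2 (norm_nonneg (y - x))])
  have h := hanti (Set.left_mem_Icc.2 zero_le_one) (Set.right_mem_Icc.2 zero_le_one) zero_le_one
  simp at h
  linarith

/-- Along a gradient step, convexity and Lipschitz continuity of the gradient combine to a
one-dimensional interpolation inequality. Here `u` is the relative decrease of the directional
derivative along the step. -/
theorem gradient_step_decrease {E : Type*} [NormedAddCommGroup E]
    [InnerProductSpace ℝ E] [CompleteSpace E] {f : E → ℝ} {f' : E → E}
    (hconv : ConvexOn ℝ Set.univ f) (hf : ∀ z, HasGradientAt f (f' z) z)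
    {D : Set E} (hD : Convex ℝ D) {L : ℝ} (hL : 0 < L)
    (hLip : ∀ u ∈ D, ∀ v ∈ D, ‖f' v - f' u‖ ≤ L * ‖v - u‖) {x y : E} (hx : x ∈ D)
    (hy : y ∈ D) {a γ : ℝ} (ha : 0 ≤ a) (hxy : y = x - a • f' x)
    (hg : f' x ≠ 0) (hγg : ‖f' y - f' x‖ ≤ γ * ‖f' x‖) :
    ∃ u, 0 ≤ u ∧ u ≤ γ ∧
      (a * (1 - u) + u ^ 2 / (2 * L)) * ‖f' x‖ ^ 2 ≤ f x - f y := by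
  set g := f' x with hgdef
  have hG : 0 < ‖g‖ := norm_pos_iff.2 hg
  have hG2 : 0 < ‖g‖ ^ 2 := by positivity
  obtain ⟨u, hu⟩ : ∃ u, ⟪f' y - g, g⟫ = -(u * ‖g‖ ^ 2) :=
    ⟨-⟪f' y - g, g⟫ / ‖g‖ ^ 2, by field_simp⟩
  have hp : ⟪f' y, g⟫ = (1 - u) * ‖g‖ ^ 2 := by
    rw [inner_sub_left, real_inner_self_eq_norm_sq] at hu
    linarith
  have habs : u * ‖g‖ ^ 2 ≤ ‖f' y - g‖ * ‖g‖ := by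
    have := (abs_le.1 (abs_real_inner_le_norm (f' y - g) g)).1
    linarith
  have hyx : y - x = -(a • g) := by rw [hxy]; abel
  have hnorm : ‖y - x‖ = a * ‖g‖ := by
    rw [hyx, norm_neg, norm_smul, Real.norm_of_nonneg ha]
  have huγ : u ≤ γ := by
    refine le_of_mul_le_mul_right (habs.trans ?_) hG2
    nlinarith
  have huL : u ≤ L * a := by
    refine le_of_mul_le_mul_right (habs.trans ?_) hG2
    have := hLip x hx y hy
    rw [hnorm] at this
    nlinarith
  have hu0 : 0 ≤ u := by
    rcases ha.eq_or_lt with rfl | ha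
    · have : y = x := by simpa using hxy
      rw [this, ← hgdef, sub_self, inner_zero_left] at hu
      nlinarith
    · have h1 := hconv.add_inner_gradient_le hf x y
      have h2 := hconv.add_inner_gradient_le hf y x
      rw [hyx, inner_neg_right, inner_smul_right, ← hgdef, real_inner_self_eq_norm_sq] at h1
      rw [← neg_sub, hyx, neg_neg, inner_smul_right, hp] at h2
      have h3 : 0 ≤ a * ‖g‖ ^ 2 * u := by linarith
      exact nonneg_of_mul_nonneg_right h3 (by positivity)
  refine ⟨u, hu0, huγ, ?_⟩
  obtain ⟨c, hc⟩ : ∃ c, c = u / L := ⟨_, rfl⟩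
  have hc0 : 0 ≤ c := hc ▸ by positivity
  have hca : c ≤ a := by rw [hc, div_le_iff₀ hL]; linarith
  have hz : x - c • g ∈ D := by
    rcases ha.eq_or_lt with rfl | ha
    · simpa [le_antisymm hca hc0] using hx
    · have := hD.add_smul_sub_mem hx hy
        (show c / a ∈ Set.Icc (0 : ℝ) 1 from ⟨by positivity, (div_le_one ha).2 hca⟩)
      rwa [hyx, smul_neg, smul_smul, div_mul_cancel₀ c ha.ne', ← sub_eq_add_neg] at this
  have h1 := le_add_inner_gradient_add_sq hf hD hLip hx hz
  have h2 := hconv.add_inner_gradient_le hf y (x - c • g)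
  have e1 : x - c • g - x = -(c • g) := by abel
  have e2 : x - c • g - y = (a - c) • g := by rw [hxy, sub_smul]; abel
  rw [e1, inner_neg_right, inner_smul_right, ← hgdef, real_inner_self_eq_norm_sq, norm_neg,
    norm_smul, Real.norm_of_nonneg hc0] at h1
  rw [e2, inner_smul_right, hp] at h2
  have hid : (a * (1 - u) + u ^ 2 / (2 * L)) * ‖g‖ ^ 2 =
      c * ‖g‖ ^ 2 - L / 2 * (c * ‖g‖) ^ 2 + (a - c) * ((1 - u) * ‖g‖ ^ 2) := by
    rw [hc]; field_simp; ring
  linarith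

/-- The scalar inequality behind the potential function argument; `s` is the inverse of the
golden ratio. -/
theorem golden_scalar_inequality_aux {s u τ : ℝ} (hs : 0 < s) (hs1 : s ^ 2 = 1 - s)
    (hu0 : 0 ≤ u) (hu1 : u < 1) (hτ : 0 ≤ τ) :
    τ * (1 - u ^ 2) ≤ s ^ 2 * τ * (τ * (1 - u) ^ 2 + u ^ 2) +
      (1 - u ^ 2) * (s * (2 * τ * (1 - u) + u ^ 2)) := by
  have hs2 : s < 1 := by nlinarith
  have hw : 0 < 1 - u ^ 2 := by nlinarith
  have hq : 0 < 1 + s - u ^ 2 := by linarith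
  obtain ⟨y, hy⟩ : ∃ y, y = 2 * s * u * (1 - u ^ 2) / (1 + s - u ^ 2) := ⟨_, rfl⟩
  have hyq : y * (1 + s - u ^ 2) = 2 * s * u * (1 - u ^ 2) := by
    rw [hy]; field_simp
  have hy2 : y ^ 2 ≤ s * (1 - u ^ 2) * u ^ 2 := by
    refine le_of_mul_le_mul_right ?_ (pow_pos hq 2)
    rw [← mul_pow, hyq]
    have h4 : 4 * s * (1 - u ^ 2) ≤ (1 + s - u ^ 2) ^ 2 := by
      have h5 : (1 + s - u ^ 2) ^ 2 - 4 * s * (1 - u ^ 2) = (1 - u ^ 2 - s) ^ 2 := by ring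
      nlinarith [sq_nonneg (1 - u ^ 2 - s)]
    have h6 : 0 ≤ s * (1 - u ^ 2) * u ^ 2 := by positivity
    nlinarith [mul_le_mul_of_nonneg_left h4 h6]
  have hcubic : 0 ≤ 1 + 2 * u + (3 * s - 2) * u ^ 2 - 2 * s * u ^ 3 := by
    have h1 : u ^ 2 ≤ u := by nlinarith
    have h2 : u ^ 3 ≤ u ^ 2 := by nlinarith [sq_nonneg u]
    nlinarith [sq_nonneg u, mul_nonneg hs.le (sub_nonneg.2 h2), mul_nonneg hs.le (sq_nonneg u)]
  have hM : 0 ≤ 2 * s * (1 - u) * y + (s ^ 2 * u ^ 2 + (1 - u ^ 2) * (2 * s * (1 - u) - 1)) := by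
    refine nonneg_of_mul_nonneg_left (b := 1 + s - u ^ 2) ?_ hq
    have hfac : (2 * s * (1 - u) * y +
        (s ^ 2 * u ^ 2 + (1 - u ^ 2) * (2 * s * (1 - u) - 1))) * (1 + s - u ^ 2) =
        (u - s) ^ 2 * (1 + 2 * u + (3 * s - 2) * u ^ 2 - 2 * s * u ^ 3) := by
      have : (2 * s * (1 - u) * y +
          (s ^ 2 * u ^ 2 + (1 - u ^ 2) * (2 * s * (1 - u) - 1))) * (1 + s - u ^ 2) =
          2 * s * (1 - u) * (y * (1 + s - u ^ 2)) +
          (s ^ 2 * u ^ 2 + (1 - u ^ 2) * (2 * s * (1 - u) - 1)) * (1 + s - u ^ 2) := by ring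
      rw [this, hyq]
      have hs3 : s ^ 3 = 2 * s - 1 := by
        have : s ^ 3 = s * s ^ 2 := by ring
        rw [this, hs1]; nlinarith
      ring_nf
      rw [hs3, hs1]
      ring
    rw [hfac]
    positivity
  nlinarith [sq_nonneg (s * (1 - u) * τ - y), mul_nonneg hτ hM]

theorem golden_scalar_inequality {s u γ τ : ℝ} (hs : 0 < s) (hs1 : s ^ 2 = 1 - s)
    (hu0 : 0 ≤ u) (huγ : u ≤ γ) (hγ1 : γ < 1) (hτ : 0 ≤ τ) :
    τ ≤ s ^ 2 * τ * ((τ * (1 - 2 * u + γ ^ 2) + u ^ 2) / (1 - γ ^ 2)) +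
      s * (2 * τ * (1 - u) + u ^ 2) := by
  have hu : 0 < 1 - u ^ 2 := by nlinarith
  have hγ : 0 < 1 - γ ^ 2 := by nlinarith
  have hsq : u ^ 2 ≤ γ ^ 2 := by gcongr
  have h1 : (τ * (1 - u) ^ 2 + u ^ 2) / (1 - u ^ 2) ≤
      (τ * (1 - 2 * u + γ ^ 2) + u ^ 2) / (1 - γ ^ 2) := by
    refine div_le_div₀ ?_ ?_ hγ (by linarith)
    · have : 0 ≤ 1 - 2 * u + γ ^ 2 := by nlinarith [sq_nonneg (1 - u)]
      positivity
    · nlinarith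
  have h2 := golden_scalar_inequality_aux hs hs1 hu0 (huγ.trans_lt hγ1) hτ
  have h3 : τ ≤ s ^ 2 * τ * ((τ * (1 - u) ^ 2 + u ^ 2) / (1 - u ^ 2)) +
      s * (2 * τ * (1 - u) + u ^ 2) := by
    refine le_of_mul_le_mul_right (h2.trans_eq ?_) hu
    field_simp
  have h4 := mul_le_mul_of_nonneg_left h1 (show 0 ≤ s ^ 2 * τ by positivity)
  linarith

/-- One step of gradient descent decreases a mixture of the potential
`‖x - xs‖² + 2A(f x - f xs)` and of `(2 / L)(f x - f xs)` by `(a / L)‖∇f(x)‖²`. -/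
theorem gradient_step_potential_decrease {E : Type*} [NormedAddCommGroup E]
    [InnerProductSpace ℝ E] [CompleteSpace E] {f : E → ℝ} {f' : E → E}
    (hconv : ConvexOn ℝ Set.univ f) (hf : ∀ z, HasGradientAt f (f' z) z)
    {D : Set E} (hD : Convex ℝ D) {L : ℝ} (hL : 0 < L)
    (hLip : ∀ u ∈ D, ∀ v ∈ D, ‖f' v - f' u‖ ≤ L * ‖v - u‖) {xs x y : E}
    (hmin : ∀ z, f xs ≤ f z) (hx : x ∈ D)
    (hy : y ∈ D) {a γ A s : ℝ} (ha : 0 ≤ a) (hγ : 0 ≤ γ) (hγ1 : γ < 1)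
    (hxy : y = x - a • f' x) (hg : f' x ≠ 0) (hγg : ‖f' y - f' x‖ ≤ γ * ‖f' x‖)
    (hs : 0 < s) (hs1 : s ^ 2 = 1 - s) (hA : A ≤ a / (1 - γ ^ 2)) :
    a / L * ‖f' x‖ ^ 2 +
        (s ^ 2 * (‖y - xs‖ ^ 2 + 2 * A * (f y - f xs)) + s * (2 / L) * (f y - f xs)) ≤
      s ^ 2 * (‖x - xs‖ ^ 2 + 2 * (a * (γ ^ 2 / (1 - γ ^ 2))) * (f x - f xs)) +
        s * (2 / L) * (f x - f xs) := by
  obtain ⟨u, hu0, huγ, hdec⟩ :=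
    gradient_step_decrease hconv hf hD hL hLip hx hy ha hxy hg hγg
  have hw : 0 < 1 - γ ^ 2 := by nlinarith
  set g := f' x with hgdef
  have hdist : ‖y - xs‖ ^ 2 = ‖x - xs‖ ^ 2 - 2 * a * ⟪g, x - xs⟫ + a ^ 2 * ‖g‖ ^ 2 := by
    have : y - xs = (x - xs) - a • g := by rw [hxy]; abel
    rw [this, norm_sub_sq_real, inner_smul_right, real_inner_comm, norm_smul, mul_pow,
      Real.norm_eq_abs, sq_abs]
    ring
  have hgap := hconv.add_inner_gradient_le hf x xs
  rw [← neg_sub, inner_neg_right, ← hgdef] at hgap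
  obtain ⟨B, hB⟩ : ∃ B, B = a / (1 - γ ^ 2) := ⟨_, rfl⟩
  have hB0 : 0 ≤ B := hB ▸ by positivity
  have hAB : a * (γ ^ 2 / (1 - γ ^ 2)) = B - a := by rw [hB]; field_simp; ring
  have hBγ : a = B * (1 - γ ^ 2) := by rw [hB]; field_simp
  have hAF : A * (f y - f xs) ≤ B * (f y - f xs) :=
    mul_le_mul_of_nonneg_right (hB ▸ hA) (sub_nonneg.2 (hmin y))
  have hV : B * (a * (1 - 2 * u + γ ^ 2) + u ^ 2 / L) * ‖g‖ ^ 2 ≤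
      (‖x - xs‖ ^ 2 + 2 * (B - a) * (f x - f xs)) -
        (‖y - xs‖ ^ 2 + 2 * A * (f y - f xs)) := by
    have h1 := mul_le_mul_of_nonneg_left hdec hB0
    have h2 := mul_le_mul_of_nonneg_left hgap ha
    have h3 : B * (a * (1 - 2 * u + γ ^ 2) + u ^ 2 / L) * ‖g‖ ^ 2 =
        2 * (B * ((a * (1 - u) + u ^ 2 / (2 * L)) * ‖g‖ ^ 2)) -
          a * (B * (1 - γ ^ 2)) * ‖g‖ ^ 2 := by
      field_simp; ring
    rw [← hBγ] at h3
    rw [h3, hdist]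
    nlinarith
  have hscalar := golden_scalar_inequality hs hs1 hu0 huγ hγ1 (mul_nonneg ha hL.le)
  have hkey : a / L ≤ s ^ 2 * (B * (a * (1 - 2 * u + γ ^ 2) + u ^ 2 / L)) +
      s * (2 / L) * (a * (1 - u) + u ^ 2 / (2 * L)) := by
    have := div_le_div_of_nonneg_right hscalar (sq_nonneg L)
    have e : a / L = a * L / L ^ 2 := by field_simp
    rw [e]
    refine this.trans_eq ?_
    rw [hB]
    field_simp
  have h1 := mul_le_mul_of_nonneg_left hV (sq_nonneg s)
  have h2 := mul_le_mul_of_nonneg_left hdec (show 0 ≤ s * (2 / L) by positivity)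
  have h3 := mul_le_mul_of_nonneg_right hkey (sq_nonneg ‖g‖)
  rw [hAB]
  nlinarith

/-- Summability of weighted gradient norms along AFFGD iterates. Indexing convention:
the paper's `α_{k-1}, γ_{k-1}` (including `α_{-1}, γ_{-1}`) are `α k, γ k` here, so the
paper's `α_k, γ_k` are `α (k+1), γ (k+1)` and the paper's `α_0, γ_0` are `α 1, γ 1`.
For a convex compact `D` containing `x*` and all iterates, on which `∇f` is
`L_D`-Lipschitz: `Σ_{k=0}^{N-1} (α_k/L_D)‖∇f(x_k)‖² ≤ ‖x_0 - x*‖² + 2α_0(γ_0²/(1-γ_0²))F_0`,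
and in particular `Σ_k α_k ‖∇f(x_k)‖² < ∞`. -/
theorem affgd_gradient_sum_bound
    {n : ℕ} (f : EuclideanSpace ℝ (Fin n) → ℝ)
    (f' : EuclideanSpace ℝ (Fin n) → EuclideanSpace ℝ (Fin n))
    (hdiff : ∀ z, HasGradientAt f (f' z) z)
    (hconv : ConvexOn ℝ Set.univ f)
    (hloc : ∀ D : Set (EuclideanSpace ℝ (Fin n)), Convex ℝ D → IsCompact D →
      ∃ L > (0 : ℝ), ∀ u ∈ D, ∀ v ∈ D, ‖f' v - f' u‖ ≤ L * ‖v - u‖)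
    (xs : EuclideanSpace ℝ (Fin n)) (hmin : ∀ z, f xs ≤ f z)
    (x : ℕ → EuclideanSpace ℝ (Fin n)) (α γ : ℕ → ℝ)
    (hγ : ∀ k, γ k ∈ Set.Ioo (0 : ℝ) 1)
    (hα0 : 0 < α 0)
    (hgrad : ∀ k, f' (x k) ≠ 0)
    (hstep : ∀ k, x (k + 1) = x k - α (k + 1) • f' (x k))
    (hα : ∀ k, α (k + 1) =
      min (γ (k + 1) / (‖f' (x (k + 1)) - f' (x k)‖ / ‖x (k + 1) - x k‖))
        ((α k / γ (k + 1) ^ 2) * ((1 - γ (k + 1) ^ 2) / (1 - γ k ^ 2))))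
    (D : Set (EuclideanSpace ℝ (Fin n)))
    (hD : Convex ℝ D) (hDc : IsCompact D) (hxs : xs ∈ D) (hxk : ∀ k, x k ∈ D)
    (LD : ℝ) (hLD : 0 < LD)
    (hLip : ∀ u ∈ D, ∀ v ∈ D, ‖f' v - f' u‖ ≤ LD * ‖v - u‖) :
    (∀ N : ℕ, 1 ≤ N →
      ∑ k ∈ Finset.range N, (α (k + 1) / LD) * ‖f' (x k)‖ ^ 2 ≤
        ‖x 0 - xs‖ ^ 2 + 2 * α 1 * (γ 1 ^ 2 / (1 - γ 1 ^ 2)) * (f (x 0) - f xs)) ∧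
    Summable (fun k : ℕ => α (k + 1) * ‖f' (x k)‖ ^ 2) := by
  have hw : ∀ k, 0 < 1 - γ k ^ 2 := fun k => by nlinarith [(hγ k).1, (hγ k).2]
  have hα_nonneg : ∀ k, 0 ≤ α k := by
    intro k
    induction k with
    | zero => exact hα0.le
    | succ k ih =>
      rw [hα k]
      have := (hγ (k + 1)).1
      have := hw k
      have := hw (k + 1)
      exact le_min (by positivity) (by positivity)
  have hgγ : ∀ k, ‖f' (x (k + 1)) - f' (x k)‖ ≤ γ (k + 1) * ‖f' (x k)‖ := by
    intro k
    have hG : 0 < ‖f' (x k)‖ := norm_pos_iff.2 (hgrad k)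
    rcases (hα_nonneg (k + 1)).eq_or_lt with h0 | hpos
    · have : x (k + 1) = x k := by rw [hstep k, ← h0]; simp
      rw [this, sub_self, norm_zero]
      exact mul_nonneg (hγ _).1.le hG.le
    · have hnorm : ‖x (k + 1) - x k‖ = α (k + 1) * ‖f' (x k)‖ := by
        rw [hstep k, sub_sub_cancel_left, norm_neg, norm_smul, Real.norm_of_nonneg hpos.le]
      have hle := (hα k).trans_le (min_le_left _ _)
      rw [hnorm] at hle
      rcases (norm_nonneg (f' (x (k + 1)) - f' (x k))).eq_or_lt with h0 | hΔ
      · rw [← h0]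
        exact mul_nonneg (hγ _).1.le hG.le
      · rw [le_div_iff₀ (by positivity)] at hle
        have : α (k + 1) * (‖f' (x (k + 1)) - f' (x k)‖ / (α (k + 1) * ‖f' (x k)‖)) =
            ‖f' (x (k + 1)) - f' (x k)‖ / ‖f' (x k)‖ := by field_simp
        rwa [this, div_le_iff₀ hG] at hle
  have hA : ∀ k, α (k + 1) * (γ (k + 1) ^ 2 / (1 - γ (k + 1) ^ 2)) ≤ α k / (1 - γ k ^ 2) := by
    intro k
    have h1 := hw k
    have h2 := hw (k + 1)
    have h3 := (hγ (k + 1)).1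
    refine (mul_le_mul_of_nonneg_right ((hα k).trans_le (min_le_right _ _))
      (by positivity)).trans_eq ?_
    field_simp
  obtain ⟨s, hs, hs1⟩ : ∃ s : ℝ, 0 < s ∧ s ^ 2 = 1 - s := by
    have h5 : Real.sqrt 5 ^ 2 = 5 := Real.sq_sqrt (by norm_num)
    refine ⟨(Real.sqrt 5 - 1) / 2, ?_, by nlinarith⟩
    have : 1 < Real.sqrt 5 := Real.lt_sqrt_of_sq_lt (by norm_num)
    linarith
  have hF : ∀ k, 0 ≤ f (x k) - f xs := fun k => sub_nonneg.2 (hmin _)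
  have hsum : ∀ N, ∑ k ∈ Finset.range N, (α (k + 1) / LD) * ‖f' (x k)‖ ^ 2 +
      (s ^ 2 * (‖x N - xs‖ ^ 2 + 2 * (α (N + 1) * (γ (N + 1) ^ 2 / (1 - γ (N + 1) ^ 2))) *
        (f (x N) - f xs)) + s * (2 / LD) * (f (x N) - f xs)) ≤
      s ^ 2 * (‖x 0 - xs‖ ^ 2 + 2 * (α 1 * (γ 1 ^ 2 / (1 - γ 1 ^ 2))) *
        (f (x 0) - f xs)) + s * (2 / LD) * (f (x 0) - f xs) := by
    intro N
    induction N with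
    | zero => simp
    | succ N ih =>
      have := gradient_step_potential_decrease hconv hdiff hD hLD hLip hmin (hxk N) (hxk (N + 1))
        (hα_nonneg (N + 1)) (hγ (N + 1)).1.le (hγ (N + 1)).2 (hstep N) (hgrad N) (hgγ N) hs hs1
        (hA (N + 1))
      rw [Finset.sum_range_succ]
      linarith
  have hbound : ∀ N, ∑ k ∈ Finset.range N, (α (k + 1) / LD) * ‖f' (x k)‖ ^ 2 ≤
      ‖x 0 - xs‖ ^ 2 + 2 * α 1 * (γ 1 ^ 2 / (1 - γ 1 ^ 2)) * (f (x 0) - f xs) := by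
    intro N
    have hcoef : ∀ k, 0 ≤ α k * (γ k ^ 2 / (1 - γ k ^ 2)) := fun k =>
      mul_nonneg (hα_nonneg k) (div_nonneg (sq_nonneg _) (hw k).le)
    have hend : 0 ≤ s ^ 2 * (‖x N - xs‖ ^ 2 +
        2 * (α (N + 1) * (γ (N + 1) ^ 2 / (1 - γ (N + 1) ^ 2))) * (f (x N) - f xs)) +
        s * (2 / LD) * (f (x N) - f xs) := by
      have := hF N
      have := hcoef (N + 1)
      positivity
    have hcrit : f' xs = 0 := by
      have h := IsLocalMin.hasFDerivAt_eq_zero (Filter.Eventually.of_forall hmin)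
        (hdiff xs).hasFDerivAt
      simpa using h
    have hquad := le_add_inner_gradient_add_sq hdiff hD hLip hxs (hxk 0)
    rw [hcrit, inner_zero_left] at hquad
    have hdist : s * (2 / LD) * (f (x 0) - f xs) ≤ s * ‖x 0 - xs‖ ^ 2 := by
      have h := mul_le_mul_of_nonneg_left (show f (x 0) - f xs ≤ LD / 2 * ‖x 0 - xs‖ ^ 2 by
        linarith) (show 0 ≤ s * (2 / LD) by positivity)
      refine h.trans_eq ?_
      field_simp
    have hmul : 0 ≤ s * (α 1 * (γ 1 ^ 2 / (1 - γ 1 ^ 2)) * (f (x 0) - f xs)) :=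
      mul_nonneg hs.le (mul_nonneg (hcoef 1) (hF 0))
    have h := hsum N
    rw [hs1] at h hend
    linarith
  refine ⟨fun N _ => hbound N, ?_⟩
  have hsummable : Summable (fun k : ℕ => (α (k + 1) / LD) * ‖f' (x k)‖ ^ 2) :=
    summable_of_sum_range_le
      (fun k => mul_nonneg (div_nonneg (hα_nonneg _) hLD.le) (sq_nonneg _)) hbound
  refine (hsummable.mul_left LD).congr fun k => ?_
  field_simp
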